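/- arXiv:0709.0910 — 9 statements merged into one kernel-verified Lean document; each statement's English description precedes it below -/
import Mathlib

section
/- Let n ≥ 3 and let x, y ∈ ℝⁿ satisfy ∑_{k=1}^n x_k = 0 and ∑_{k=1}^n y_k = 0. Then M(x) = M(y) if and only if x = y or x = −y. -/
open scoped BigOperators Pointwise

noncomputable def mmap {n : ℕ} (x : Fin n → ℝ) : Matrix (Fin n) (Fin n) ℝ :=
  fun k l => |x k - x l|

noncomputable def chi {n : ℕ} (U : Finset (Fin n)) : Fin n → ℝ :=
  fun j => if j ∈ U then 1 else 0

noncomputable def permVec {n : ℕ} (π : Equiv.Perm (Fin n)) : Fin n → ℝ :=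
  fun j => ((π j : ℕ) : ℝ) + 1

noncomputable def Mperm {n : ℕ} (π : Equiv.Perm (Fin n)) : Matrix (Fin n) (Fin n) ℝ :=
  mmap (permVec π)

def Npi {n : ℕ} (π : Equiv.Perm (Fin n)) : Set (Fin n → ℝ) :=
  {x | (∑ k, x k) = 0 ∧ ∀ k l : Fin n, π k < π l → x k ≤ x l}

def Ebn (n : ℕ) : Set (Matrix (Fin n) (Fin n) ℝ) :=
  {X | ∃ x : Fin n → ℝ, (∀ k l : Fin n, k ≠ l → 1 ≤ |x k - x l|) ∧ X = mmap x}

noncomputable def Qn (n : ℕ) : Set (Matrix (Fin n) (Fin n) ℝ) :=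
  convexHull ℝ (Ebn n)

noncomputable def Pn (n : ℕ) : Set (Matrix (Fin n) (Fin n) ℝ) :=
  convexHull ℝ {X | ∃ π : Equiv.Perm (Fin n), X = Mperm π}

noncomputable def cutCone (n : ℕ) : Set (Matrix (Fin n) (Fin n) ℝ) :=
  {X | ∃ lam : Finset (Fin n) → ℝ, (∀ U, 0 ≤ lam U) ∧
    X = ∑ U : Finset (Fin n), lam U • mmap (chi U)}

def incident {n : ℕ} (π : Equiv.Perm (Fin n)) (U : Finset (Fin n)) : Prop :=
  U.Nonempty ∧ U ≠ Finset.univ ∧ ∀ j, j ∈ U ↔ (π j : ℕ) + 1 ≤ U.card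

def overRidge {n : ℕ} (π : Equiv.Perm (Fin n)) (V : Finset (Fin n)) : Prop :=
  ∃ k : ℕ, 1 ≤ k ∧ k ≤ n - 1 ∧
    ∀ j, j ∈ V ↔ ((π j : ℕ) + 1 ≤ k - 1 ∨ (π j : ℕ) + 1 = k + 1)

noncomputable def halfline {n : ℕ} (π : Equiv.Perm (Fin n)) (U : Finset (Fin n)) :
    Set (Matrix (Fin n) (Fin n) ℝ) :=
  {X | ∃ t : ℝ, 0 ≤ t ∧ X = Mperm π + t • mmap (chi U)}

noncomputable def antipode {n : ℕ} (π : Equiv.Perm (Fin n)) : Equiv.Perm (Fin n) :=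
  π.trans Fin.revPerm

theorem stmt0 (n : ℕ) (hn : 3 ≤ n) (x y : Fin n → ℝ)
    (hx : (∑ k, x k) = 0) (hy : (∑ k, y k) = 0) :
    mmap x = mmap y ↔ (x = y ∨ x = -y) := by
  constructor
  · intro h
    have hn0 : (0:ℝ) < n := by
      have : 0 < n := by omega
      exact_mod_cast this
    have hsq : ∀ k l, (x k - x l)^2 = (y k - y l)^2 := by
      intro k l
      have h1 : |x k - x l| = |y k - y l| := congrFun (congrFun h k) l
      rw [← sq_abs, h1, sq_abs]
    have key : ∀ z : Fin n → ℝ, (∑ k, z k) = 0 → ∀ k,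
        ∑ l, (z k - z l)^2 = n * (z k)^2 + ∑ l, (z l)^2 := by
      intro z hz k
      have h1 : ∀ l, (z k - z l)^2 = (z k)^2 - 2 * z k * z l + (z l)^2 := by
        intro l; ring
      simp only [h1, Finset.sum_add_distrib, Finset.sum_sub_distrib, ← Finset.mul_sum, hz]
      simp
    have h2 : ∀ k, n * (x k)^2 + ∑ l, (x l)^2 = n * (y k)^2 + ∑ l, (y l)^2 := by
      intro k
      rw [← key x hx k, ← key y hy k]
      exact Finset.sum_congr rfl fun l _ => hsq k l
    have h3 : ∑ k, (n * (x k)^2 + ∑ l, (x l)^2) = ∑ k, (n * (y k)^2 + ∑ l, (y l)^2) :=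
      Finset.sum_congr rfl fun k _ => h2 k
    simp only [Finset.sum_add_distrib, ← Finset.mul_sum, Finset.sum_const, Finset.card_univ,
      Fintype.card_fin, nsmul_eq_mul] at h3
    have hS : ∑ l, (x l)^2 = ∑ l, (y l)^2 := by
      apply mul_left_cancel₀ hn0.ne'
      linarith
    have h4 : ∀ k, (x k)^2 = (y k)^2 := by
      intro k
      apply mul_left_cancel₀ hn0.ne'
      linarith [h2 k]
    have h5 : ∀ k l, x k * x l = y k * y l := by
      intro k l
      nlinarith [hsq k l, h4 k, h4 l]
    by_cases h0 : ∀ k, x k = 0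
    · left
      funext k
      have h6 := h4 k
      rw [h0 k] at h6 ⊢
      exact (pow_eq_zero_iff (two_ne_zero)).1 (by simpa using h6.symm) |>.symm
    · push Not at h0
      obtain ⟨a, ha⟩ := h0
      rcases sq_eq_sq_iff_eq_or_eq_neg.1 (h4 a) with h6 | h6
      · left
        funext l
        apply mul_left_cancel₀ ha
        rw [h5 a l, h6]
      · right
        funext l
        apply mul_left_cancel₀ ha
        rw [h5 a l, h6, Pi.neg_apply]
        ring
  · rintro (rfl | rfl)
    · rfl
    · funext k l
      simp only [mmap, Pi.neg_apply]
      rw [← abs_neg]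
      congr 1
      ring
end

section
/- Let n ≥ 3 and let π be a permutation of [n]. Then: (1) M is positively linear on N_π, i.e., M(x + y) = M(x) + M(y) and M(λx) = λ·M(x) for all x, y ∈ N_π and λ ≥ 0; (2) M restricted to N_π is injective; (3) the image M(N_π) = {M(x) : x ∈ N_π} equals the set of all finite nonnegative combinations of the matrices M(χ^U), where U ranges over the nonempty proper subsets of [n] incident to π. -/
open scoped BigOperators Pointwise

lemma aux_le {n : ℕ} {π : Equiv.Perm (Fin n)} {x : Fin n → ℝ}
    (hx : ∀ k l : Fin n, π k < π l → x k ≤ x l) {k l : Fin n} (h : π k ≤ π l) : x k ≤ x l := by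
  rcases h.lt_or_eq with h | h
  · exact hx k l h
  · rw [π.injective h]

lemma aux_abs {n : ℕ} {π : Equiv.Perm (Fin n)} {x : Fin n → ℝ}
    (hx : ∀ k l : Fin n, π k < π l → x k ≤ x l) {k l : Fin n} (h : π k ≤ π l) :
    mmap x k l = x l - x k := by
  have := aux_le hx h
  unfold mmap
  rw [abs_sub_comm, abs_of_nonneg (by linarith)]

lemma mmap_symm {n : ℕ} (x : Fin n → ℝ) (k l : Fin n) : mmap x k l = mmap x l k := by
  unfold mmap
  rw [abs_sub_comm]

lemma aux_ext {n : ℕ} (π : Equiv.Perm (Fin n)) {A B : Matrix (Fin n) (Fin n) ℝ}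
    (hA : ∀ k l, A k l = A l k) (hB : ∀ k l, B k l = B l k)
    (h : ∀ k l, π k ≤ π l → A k l = B k l) : A = B := by
  ext k l
  rcases le_total (π k) (π l) with h1 | h1
  · exact h k l h1
  · rw [hA, hB]; exact h l k h1

lemma sum_symm {n : ℕ} (lam : Finset (Fin n) → ℝ) (k l : Fin n) :
    (∑ U : Finset (Fin n), lam U • mmap (chi U)) k l =
    (∑ U : Finset (Fin n), lam U • mmap (chi U)) l k := by
  simp only [Matrix.sum_apply, Matrix.smul_apply]
  exact Finset.sum_congr rfl fun U _ => by rw [mmap_symm]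

def Vset {n : ℕ} (π : Equiv.Perm (Fin n)) (i : ℕ) : Finset (Fin n) :=
  Finset.univ.filter fun j => (π j : ℕ) < i

lemma Vset_card {n : ℕ} (π : Equiv.Perm (Fin n)) (i : ℕ) (hi : i ≤ n) :
    (Vset π i).card = i := by
  have : (Vset π i).map (π.toEmbedding.trans Fin.valEmbedding) = Finset.range i := by
    ext a
    simp only [Vset, Finset.mem_map, Finset.mem_filter, Finset.mem_univ, true_and,
      Finset.mem_range]
    constructor
    · rintro ⟨j, hj, rfl⟩
      exact hj
    · intro ha
      refine ⟨π.symm ⟨a, by omega⟩, ?_, ?_⟩ <;> simp [ha]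
  rw [← Finset.card_map, this, Finset.card_range]

lemma Vset_incident {n : ℕ} (π : Equiv.Perm (Fin n)) (i : ℕ) (h0 : 0 < i) (hi : i < n) :
    incident π (Vset π i) := by
  have hc := Vset_card π i hi.le
  refine ⟨?_, ?_, ?_⟩
  · rw [← Finset.card_pos]; omega
  · intro h
    rw [h, Finset.card_univ, Fintype.card_fin] at hc
    omega
  · intro j
    rw [hc]
    exact Iff.trans (by simp [Vset]) Nat.lt_iff_add_one_le

lemma chi_anti {n : ℕ} {π : Equiv.Perm (Fin n)} {U : Finset (Fin n)} (hU : incident π U)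
    {k l : Fin n} (h : π k ≤ π l) : chi U l ≤ chi U k := by
  have h1 := hU.2.2 k
  have h2 := hU.2.2 l
  have h3 : (π k : ℕ) ≤ π l := h
  unfold chi
  by_cases hl : l ∈ U
  · have : k ∈ U := by rw [h1]; rw [h2] at hl; omega
    simp [hl, this]
  · simp only [hl, if_false]
    split_ifs <;> norm_num

lemma mmap_chi {n : ℕ} {π : Equiv.Perm (Fin n)} {U : Finset (Fin n)} (hU : incident π U)
    {k l : Fin n} (h : π k ≤ π l) : mmap (chi U) k l = chi U k - chi U l := by
  have := chi_anti hU h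
  unfold mmap
  rw [abs_of_nonneg (by linarith)]

lemma sum_tele (y : ℕ → ℝ) (a b m : ℕ) (hab : a ≤ b) (hb : b ≤ m) :
    ∑ i ∈ Finset.range m, (y (i+1) - y i) *
      ((if a < i + 1 then (1:ℝ) else 0) - (if b < i + 1 then 1 else 0)) = y b - y a := by
  induction m, hb using Nat.le_induction with
  | base =>
    induction b, hab using Nat.le_induction with
    | base => simp
    | succ b hb ih =>
      rw [Finset.sum_range_succ, if_pos (by omega), if_neg (by omega)]
      have : ∑ i ∈ Finset.range b, (y (i+1) - y i) *
        ((if a < i + 1 then (1:ℝ) else 0) - (if b + 1 < i + 1 then 1 else 0)) = y b - y a := by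
        rw [← ih]
        refine Finset.sum_congr rfl fun i hi => ?_
        have := Finset.mem_range.1 hi
        rw [if_neg (show ¬ b + 1 < i + 1 by omega), if_neg (show ¬ b < i + 1 by omega)]
      rw [this]; ring
  | succ m hm ih =>
    rw [Finset.sum_range_succ, ih, if_pos (by omega), if_pos (by omega)]
    ring

theorem stmt1 (n : ℕ) (hn : 3 ≤ n) (π : Equiv.Perm (Fin n)) :
    (∀ x ∈ Npi π, ∀ y ∈ Npi π, mmap (x + y) = mmap x + mmap y) ∧
    (∀ x ∈ Npi π, ∀ c : ℝ, 0 ≤ c → mmap (c • x) = c • mmap x) ∧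
    Set.InjOn mmap (Npi π) ∧
    mmap '' (Npi π) =
      {X | ∃ lam : Finset (Fin n) → ℝ, (∀ U, 0 ≤ lam U) ∧
        (∀ U, lam U ≠ 0 → incident π U) ∧
        X = ∑ U : Finset (Fin n), lam U • mmap (chi U)} := by
  refine ⟨?_, ?_, ?_, ?_⟩
  · intro x hx y hy
    refine aux_ext π (mmap_symm _) ?_ ?_
    · intro k l
      rw [Matrix.add_apply, Matrix.add_apply, mmap_symm x, mmap_symm y]
    · intro k l h
      have hxy : ∀ k l : Fin n, π k < π l → (x + y) k ≤ (x + y) l := fun k l h =>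
        add_le_add (hx.2 k l h) (hy.2 k l h)
      rw [Matrix.add_apply, aux_abs hx.2 h, aux_abs hy.2 h, aux_abs hxy h]
      simp only [Pi.add_apply]
      ring
  · intro x hx c hc
    ext k l
    simp only [mmap, Matrix.smul_apply, Pi.smul_apply, smul_eq_mul]
    rw [← mul_sub, abs_mul, abs_of_nonneg hc]
  · intro x hx y hy hxy
    have hd : ∀ k l, x l - x k = y l - y k := by
      intro k l
      have h1 : mmap x k l = mmap y k l := by rw [hxy]
      rcases le_total (π k) (π l) with h | h
      · rw [aux_abs hx.2 h, aux_abs hy.2 h] at h1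
        exact h1
      · rw [mmap_symm, mmap_symm y, aux_abs hx.2 h, aux_abs hy.2 h] at h1
        linarith
    funext k
    have h2 : ∑ l, (x l - x k) = ∑ l, (y l - y k) := Finset.sum_congr rfl fun l _ => hd k l
    rw [Finset.sum_sub_distrib, Finset.sum_sub_distrib, hx.1, hy.1] at h2
    simp only [Finset.sum_const, Finset.card_univ, Fintype.card_fin, nsmul_eq_mul,
      zero_sub, neg_inj] at h2
    have hn0 : (n : ℝ) ≠ 0 := by
      have : n ≠ 0 := by omega
      exact_mod_cast this
    exact mul_left_cancel₀ hn0 h2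
  · ext X
    constructor
    · rintro ⟨x, hx, rfl⟩
      obtain ⟨y, hy⟩ : ∃ y : ℕ → ℝ, ∀ j, y (π j : ℕ) = x j := by
        refine ⟨fun i => if h : i < n then x (π.symm ⟨i, h⟩) else 0, fun j => ?_⟩
        simp
      have hmono : ∀ i ∈ Finset.range (n - 1), 0 ≤ y (i + 1) - y i := by
        intro i hi
        have hi := Finset.mem_range.1 hi
        have h1 := hy (π.symm ⟨i, by omega⟩)
        have h2 := hy (π.symm ⟨i + 1, by omega⟩)
        simp only [Equiv.apply_symm_apply] at h1 h2
        rw [h1, h2, sub_nonneg]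
        apply aux_le hx.2
        simp
      refine ⟨fun U => ∑ i ∈ Finset.range (n - 1),
        if U = Vset π (i + 1) then y (i + 1) - y i else 0, ?_, ?_, ?_⟩
      · intro U
        refine Finset.sum_nonneg fun i hi => ?_
        split_ifs
        · exact hmono i hi
        · exact le_rfl
      · intro U hU
        obtain ⟨i, hi, h⟩ := Finset.exists_ne_zero_of_sum_ne_zero hU
        have hi := Finset.mem_range.1 hi
        have hUV : U = Vset π (i + 1) := by
          by_contra hne
          exact h (if_neg hne)
        rw [hUV]
        exact Vset_incident π _ (by omega) (by omega)
      · refine aux_ext π (mmap_symm _) (sum_symm _) ?_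
        intro k l h
        rw [aux_abs hx.2 h]
        simp only [Matrix.sum_apply, Matrix.smul_apply, smul_eq_mul, Finset.sum_mul]
        rw [Finset.sum_comm]
        simp only [ite_mul, zero_mul, Finset.sum_ite_eq', Finset.mem_univ, if_true]
        rw [← hy k, ← hy l, ← sum_tele y (π k) (π l) (n - 1) h (by have := (π l).2; omega)]
        refine Finset.sum_congr rfl fun i hi => ?_
        have hi := Finset.mem_range.1 hi
        rw [mmap_chi (Vset_incident π _ (by omega) (by omega)) h]
        simp [chi, Vset]
    · rintro ⟨lam, h0, hinc, rfl⟩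
      have hn0 : (n : ℝ) ≠ 0 := by
        have : n ≠ 0 := by omega
        exact_mod_cast this
      let z : Fin n → ℝ := fun j => ∑ U : Finset (Fin n), lam U * chi U j
      have hz : ∀ k l, π k ≤ π l → z l ≤ z k := by
        intro k l h
        refine Finset.sum_le_sum fun U _ => ?_
        by_cases hU : lam U = 0
        · simp [hU]
        · exact mul_le_mul_of_nonneg_left (chi_anti (hinc U hU) h) (h0 U)
      have hm : ∀ k l, π k < π l → (∑ j, z j) / n - z k ≤ (∑ j, z j) / n - z l := by
        intro k l h
        have := hz k l h.le
        linarith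
      refine ⟨fun k => (∑ j, z j) / n - z k, ⟨?_, hm⟩, ?_⟩
      · rw [Finset.sum_sub_distrib]
        simp only [Finset.sum_const, Finset.card_univ, Fintype.card_fin, nsmul_eq_mul]
        field_simp
        ring
      · refine aux_ext π (mmap_symm _) (sum_symm _) ?_
        intro k l h
        rw [aux_abs hm h]
        simp only [Matrix.sum_apply, Matrix.smul_apply, smul_eq_mul]
        have : (∑ j, z j) / n - z l - ((∑ j, z j) / n - z k) = z k - z l := by ring
        rw [this]
        simp only [z]
        rw [← Finset.sum_sub_distrib]
        refine Finset.sum_congr rfl fun U _ => ?_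
        by_cases hU : lam U = 0
        · simp [hU]
        · rw [mmap_chi (hinc U hU) h]
          ring
end

section
/- Let n ≥ 3 and let E_n := {M(x) : x ∈ ℝⁿ}, a subset of the space of n×n real matrices with its usual topology. Then E_n ∖ {0}, with the subspace topology, is homeomorphic to the Cartesian product of ℝ with the real projective space of dimension n−2 (the projectivization of ℝ^{n−1}). -/
open scoped BigOperators Pointwise

noncomputable instance projTop (m : ℕ) : TopologicalSpace (Projectivization ℝ (Fin m → ℝ)) :=
  instTopologicalSpaceQuotient

noncomputable def gmap {m : ℕ} (v : Fin m → ℝ) : Matrix (Fin (m+1)) (Fin (m+1)) ℝ :=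
  mmap (Fin.cons 0 v : Fin (m+1) → ℝ)

noncomputable def rrow {m : ℕ} (X : Matrix (Fin (m+1)) (Fin (m+1)) ℝ) : ℝ :=
  ‖(fun i : Fin m => X 0 i.succ)‖

theorem continuous_mmap {n : ℕ} : Continuous (mmap (n := n)) := by
  unfold mmap
  refine continuous_pi fun k => continuous_pi fun l => ?_
  fun_prop

theorem continuous_gmap {m : ℕ} : Continuous (gmap (m := m)) := by
  unfold gmap
  refine continuous_mmap.comp ?_
  refine continuous_pi fun k => ?_
  refine Fin.cases ?_ (fun i => ?_) k
  · simpa using continuous_const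
  · simpa using continuous_apply i

theorem continuous_rrow {m : ℕ} : Continuous (rrow (m := m)) := by
  unfold rrow
  refine continuous_norm.comp (continuous_pi fun i => ?_)
  exact (continuous_apply i.succ).comp (continuous_apply (0 : Fin (m+1)))

theorem rrow_smul {m : ℕ} (a : ℝ) (X : Matrix (Fin (m+1)) (Fin (m+1)) ℝ) :
    rrow (a • X) = |a| * rrow X := by
  have : (fun i : Fin m => (a • X) 0 i.succ) = a • (fun i : Fin m => X 0 i.succ) := by
    ext i; simp
  unfold rrow
  rw [this, norm_smul, Real.norm_eq_abs]

theorem rrow_gmap {m : ℕ} (v : Fin m → ℝ) : rrow (gmap v) = ‖v‖ := by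
  have : (fun i : Fin m => gmap v 0 i.succ) = fun i => ‖v i‖ := by
    ext i; simp [gmap, mmap]
  unfold rrow
  rw [this]
  simp only [Pi.norm_def, nnnorm_norm]

theorem gmap_smul {m : ℕ} (a : ℝ) (v : Fin m → ℝ) : gmap (a • v) = |a| • gmap v := by
  have : (Fin.cons 0 (a • v) : Fin (m+1) → ℝ) = a • (Fin.cons 0 v : Fin (m+1) → ℝ) := by
    ext k
    refine Fin.cases ?_ (fun i => ?_) k <;> simp
  unfold gmap
  rw [this]
  ext k l
  simp [mmap, ← mul_sub, abs_mul]

theorem gmap_sub {m : ℕ} (x : Fin (m+1) → ℝ) :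
    gmap (fun i : Fin m => x i.succ - x 0) = mmap x := by
  ext k l
  refine Fin.cases ?_ (fun i => ?_) k <;> refine Fin.cases ?_ (fun j => ?_) l <;>
    simp [gmap, mmap, abs_sub_comm]

theorem gmap_inj {m : ℕ} {v w : Fin m → ℝ} (hv : v ≠ 0) (h : gmap v = gmap w) :
    ∃ c : ℝ, c ≠ 0 ∧ v = c • w := by
  have h1 : ∀ i, v i ^ 2 = w i ^ 2 := fun i => by
    have := congrFun (congrFun h 0) i.succ
    simp only [gmap, mmap, Fin.cons_zero, Fin.cons_succ, zero_sub, abs_neg] at this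
    exact (sq_eq_sq_iff_abs_eq_abs _ _).2 this
  have h2 : ∀ i j, (v i - v j) ^ 2 = (w i - w j) ^ 2 := fun i j => by
    have := congrFun (congrFun h i.succ) j.succ
    simp only [gmap, mmap, Fin.cons_succ] at this
    exact (sq_eq_sq_iff_abs_eq_abs _ _).2 this
  have h3 : ∀ i j, v i * v j = w i * w j := fun i j => by
    linarith [h1 i, h1 j, h2 i j]
  obtain ⟨i, hi⟩ := Function.ne_iff.1 hv
  have hi : v i ≠ 0 := hi
  have hw : w i ≠ 0 := fun h0 => hi (by have := h1 i; rw [h0] at this; simpa using this)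
  refine ⟨w i / v i, div_ne_zero hw hi, ?_⟩
  ext j
  have := h3 i j
  simp only [Pi.smul_apply, smul_eq_mul]
  field_simp
  linarith

noncomputable def phiSub {m : ℕ} (v : {v : Fin m → ℝ // v ≠ 0}) :
    Matrix (Fin (m+1)) (Fin (m+1)) ℝ := ‖v.1‖⁻¹ • gmap v.1

noncomputable def phi {m : ℕ} : Projectivization ℝ (Fin m → ℝ) → Matrix (Fin (m+1)) (Fin (m+1)) ℝ :=
  Projectivization.lift phiSub (by
    rintro ⟨a, ha⟩ ⟨b, hb⟩ t h
    simp only at h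
    subst h
    have ht : t ≠ 0 := by rintro rfl; simp at ha
    have ht' : |t| ≠ 0 := abs_ne_zero.2 ht
    simp only [phiSub, gmap_smul, norm_smul, Real.norm_eq_abs, smul_smul]
    congr 1
    field_simp)

theorem phi_mk {m : ℕ} (v : Fin m → ℝ) (hv : v ≠ 0) :
    phi (Projectivization.mk ℝ v hv) = ‖v‖⁻¹ • gmap v := rfl

theorem continuous_phi {m : ℕ} : Continuous (phi (m := m)) := by
  have h1 : Continuous fun v : {v : Fin m → ℝ // v ≠ 0} => ‖v.1‖⁻¹ :=
    (continuous_norm.comp continuous_subtype_val).inv₀ fun v => norm_ne_zero_iff.2 v.2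
  have h2 : Continuous fun v : {v : Fin m → ℝ // v ≠ 0} => gmap v.1 :=
    continuous_gmap.comp continuous_subtype_val
  have h3 : Continuous (phiSub (m := m)) := h1.smul h2
  exact continuous_quot_lift _ h3

theorem rrow_phi {m : ℕ} (p : Projectivization ℝ (Fin m → ℝ)) : rrow (phi p) = 1 := by
  induction p using Projectivization.ind with
  | h v hv =>
    rw [phi_mk, rrow_smul, rrow_gmap, abs_inv, abs_norm]
    exact inv_mul_cancel₀ (norm_ne_zero_iff.2 hv)

theorem phi_injective {m : ℕ} : Function.Injective (phi (m := m)) := by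
  intro p q h
  induction p using Projectivization.ind with
  | h v hv =>
  induction q using Projectivization.ind with
  | h w hw =>
    have hv' := norm_ne_zero_iff.2 hv
    have hw' := norm_ne_zero_iff.2 hw
    have e : ∀ u : Fin m → ℝ, ‖u‖⁻¹ • gmap u = gmap (‖u‖⁻¹ • u) := fun u => by
      rw [gmap_smul, abs_inv, abs_norm]
    rw [phi_mk, phi_mk, e, e] at h
    obtain ⟨c, hc, hcw⟩ := gmap_inj (smul_ne_zero (inv_ne_zero hv') hv) h
    rw [Projectivization.mk_eq_mk_iff']
    refine ⟨‖v‖ * (c * ‖w‖⁻¹), ?_⟩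
    rw [mul_smul, mul_smul, ← hcw, smul_smul, mul_inv_cancel₀ hv', one_smul]

theorem compact_proj {m : ℕ} : CompactSpace (Projectivization ℝ (Fin m → ℝ)) := by
  let f : Metric.sphere (0 : Fin m → ℝ) 1 → Projectivization ℝ (Fin m → ℝ) := fun v =>
    Projectivization.mk ℝ v.1 (by
      intro h; have := v.2; rw [h] at this; simp at this)
  have hf : Continuous f := by
    refine continuous_quotient_mk'.comp (Continuous.subtype_mk continuous_subtype_val _)
  have hs : Function.Surjective f := by
    intro p
    induction p using Projectivization.ind with
    | h v hv =>
      have hv' := norm_ne_zero_iff.2 hv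
      refine ⟨⟨‖v‖⁻¹ • v, by simp [norm_smul, hv']⟩, ?_⟩
      rw [Projectivization.mk_eq_mk_iff']
      exact ⟨‖v‖⁻¹, rfl⟩
  exact hs.compactSpace hf

theorem exists_phi {m : ℕ} {X : Matrix (Fin (m+1)) (Fin (m+1)) ℝ}
    (hX : X ∈ Set.range (mmap (n := m+1)) \ {0}) :
    0 < rrow X ∧ ∃ p, phi p = (rrow X)⁻¹ • X := by
  obtain ⟨⟨x, rfl⟩, h0⟩ := hX
  rw [← gmap_sub] at h0 ⊢
  set v : Fin m → ℝ := fun i => x i.succ - x 0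
  have hv : v ≠ 0 := by
    intro h
    apply h0
    rw [h]
    have := gmap_smul (0 : ℝ) (0 : Fin m → ℝ)
    simpa using this
  rw [rrow_gmap]
  exact ⟨norm_pos_iff.2 hv, Projectivization.mk ℝ v hv, phi_mk v hv⟩

theorem mem_phi {m : ℕ} (t : ℝ) (p : Projectivization ℝ (Fin m → ℝ)) :
    Real.exp t • phi p ∈ Set.range (mmap (n := m+1)) \ {0} := by
  refine ⟨?_, ?_⟩
  · induction p using Projectivization.ind with
    | h v hv =>
      refine ⟨Fin.cons 0 ((Real.exp t * ‖v‖⁻¹) • v), ?_⟩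
      change gmap _ = _
      rw [gmap_smul, phi_mk, smul_smul, abs_of_nonneg (by positivity)]
  · intro h
    have h : Real.exp t • phi p = 0 := h
    have h1 := rrow_phi p
    rw [(smul_eq_zero.1 h).resolve_left (Real.exp_ne_zero t)] at h1
    have := rrow_smul (0 : ℝ) (0 : Matrix (Fin (m+1)) (Fin (m+1)) ℝ)
    simp at this
    rw [h1] at this
    exact one_ne_zero this

theorem main_homeo (m : ℕ) :
    Nonempty ((↥(Set.range (mmap (n := m+1)) \ {0})) ≃ₜ
      (ℝ × Projectivization ℝ (Fin m → ℝ))) := by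
  haveI := compact_proj (m := m)
  have hemb : Topology.IsEmbedding (phi (m := m)) :=
    (continuous_phi.isClosedEmbedding phi_injective).isEmbedding
  choose hpos q hq using
    fun X : ↥(Set.range (mmap (n := m+1)) \ {0}) => exists_phi X.2
  refine ⟨⟨⟨fun X => (Real.log (rrow X.1), q X),
    fun tp => ⟨Real.exp tp.1 • phi tp.2, mem_phi tp.1 tp.2⟩, ?_, ?_⟩, ?_, ?_⟩⟩
  · intro X
    apply Subtype.ext
    change Real.exp (Real.log (rrow X.1)) • phi (q X) = X.1
    rw [Real.exp_log (hpos X), hq, smul_smul, mul_inv_cancel₀ (hpos X).ne', one_smul]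
  · rintro ⟨t, p⟩
    have hr : rrow (Real.exp t • phi p) = Real.exp t := by
      rw [rrow_smul, rrow_phi, mul_one, abs_of_pos (Real.exp_pos t)]
    refine Prod.ext ?_ ?_
    · change Real.log (rrow (Real.exp t • phi p)) = t
      rw [hr, Real.log_exp]
    · apply phi_injective
      change phi (q ⟨Real.exp t • phi p, _⟩) = phi p
      rw [hq]
      change (rrow (Real.exp t • phi p))⁻¹ • (Real.exp t • phi p) = phi p
      rw [hr, smul_smul, inv_mul_cancel₀ (Real.exp_ne_zero t), one_smul]
  · have hc : Continuous fun X : ↥(Set.range (mmap (n := m+1)) \ {0}) => rrow X.1 :=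
      continuous_rrow.comp continuous_subtype_val
    refine Continuous.prodMk (hc.log fun X => (hpos X).ne') ?_
    rw [hemb.continuous_iff]
    have : phi ∘ q = fun X => (rrow X.1)⁻¹ • X.1 := funext hq
    change Continuous (phi ∘ q)
    rw [this]
    exact (hc.inv₀ fun X => (hpos X).ne').smul continuous_subtype_val
  · refine Continuous.subtype_mk ?_ _
    exact (Real.continuous_exp.comp continuous_fst).smul (continuous_phi.comp continuous_snd)

theorem stmt2 (n : ℕ) (hn : 3 ≤ n) :
    Nonempty ((↥(Set.range (mmap (n := n)) \ {0})) ≃ₜ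
      (ℝ × Projectivization ℝ (Fin (n - 1) → ℝ))) := by
  obtain ⟨m, rfl⟩ : ∃ m, n = m + 1 := ⟨n - 1, by omega⟩
  exact main_homeo m
end

section
/- Let n ≥ 3. The convex hull of E_n := {M(x) : x ∈ ℝⁿ} equals the cut cone C_n, i.e., conv(E_n) = {∑_{U ⊆ [n]} λ_U · M(χ^U) : λ_U ≥ 0 for all U}. -/
open scoped BigOperators Pointwise

lemma mmap_smul_nonneg {n : ℕ} (c : ℝ) (hc : 0 ≤ c) (x : Fin n → ℝ) :
    mmap (c • x) = c • mmap x := by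
  ext k l
  simp only [mmap, Pi.smul_apply, smul_eq_mul, Matrix.smul_apply]
  rw [← mul_sub, abs_mul, abs_of_nonneg hc]

lemma cutCone_add_cut {n : ℕ} {X : Matrix (Fin n) (Fin n) ℝ} (hX : X ∈ cutCone n)
    (c : ℝ) (hc : 0 ≤ c) (U : Finset (Fin n)) : X + c • mmap (chi U) ∈ cutCone n := by
  obtain ⟨lam, h0, rfl⟩ := hX
  refine ⟨fun V => lam V + if V = U then c else 0, fun V => ?_, ?_⟩
  · have := h0 V
    dsimp only
    split_ifs <;> linarith
  · simp [add_smul, Finset.sum_add_distrib, ite_smul]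

lemma cutCone_zero (n : ℕ) : (0 : Matrix (Fin n) (Fin n) ℝ) ∈ cutCone n :=
  ⟨fun _ => 0, fun _ => le_rfl, by simp⟩

lemma mmap_mem_cutCone {n : ℕ} (s : Finset ℝ) :
    ∀ x : Fin n → ℝ, (∀ j, x j ∈ s) → mmap x ∈ cutCone n := by
  induction s using Finset.induction_on_max with
  | empty =>
    intro x hx
    have : mmap x = 0 := by
      ext k l
      exact absurd (hx k) (by simp)
    rw [this]
    exact cutCone_zero n
  | insert a s hs ih =>
    intro x hx
    rcases s.eq_empty_or_nonempty with rfl | hne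
    · have : mmap x = 0 := by
        ext k l
        have h1 : x k = a := by simpa using hx k
        have h2 : x l = a := by simpa using hx l
        simp [mmap, h1, h2]
      rw [this]
      exact cutCone_zero n
    · set m := s.max' hne with hm
      have hms : m ∈ s := s.max'_mem hne
      have hma : m < a := hs m hms
      have hle : ∀ j, x j ≠ a → x j ∈ s ∧ x j ≤ m := fun j hj => by
        have h := (Finset.mem_insert.1 (hx j)).resolve_left hj
        exact ⟨h, s.le_max' _ h⟩
      have hy := ih (fun j => if x j = a then m else x j) (fun j => by
        by_cases h : x j = a
        · simpa [h] using hms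
        · simpa [h] using (hle j h).1)
      have := cutCone_add_cut hy (a - m) (by linarith) (Finset.univ.filter fun j => x j = a)
      convert this using 1
      ext k l
      simp only [mmap, chi, Matrix.add_apply, Matrix.smul_apply, smul_eq_mul,
        Finset.mem_filter, Finset.mem_univ, true_and]
      by_cases hk : x k = a <;> by_cases hl : x l = a
      · simp [hk, hl]
      · have := (hle l hl).2
        simp only [hk, hl, if_true, if_false]
        rw [abs_of_nonneg (by linarith), abs_of_nonneg (by linarith)]
        norm_num
      · have := (hle k hk).2
        simp only [hk, hl, if_true, if_false]
        rw [abs_of_nonpos (by linarith), abs_of_nonpos (by linarith)]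
        norm_num
      · simp [hk, hl]

lemma convex_cutCone (n : ℕ) : Convex ℝ (cutCone n) := by
  rintro _ ⟨f, hf, rfl⟩ _ ⟨g, hg, rfl⟩ a b ha hb _
  refine ⟨fun U => a * f U + b * g U,
    fun U => add_nonneg (mul_nonneg ha (hf U)) (mul_nonneg hb (hg U)), ?_⟩
  simp [add_smul, Finset.sum_add_distrib, Finset.smul_sum, mul_smul]

theorem stmt3 (n : ℕ) (hn : 3 ≤ n) :
    convexHull ℝ (Set.range (mmap (n := n))) = cutCone n := by
  apply Set.Subset.antisymm
  · refine convexHull_min ?_ (convex_cutCone n)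
    rintro _ ⟨x, rfl⟩
    exact mmap_mem_cutCone (Finset.univ.image x) x (fun j => by simp)
  · rintro _ ⟨lam, h0, rfl⟩
    set N : ℝ := (Fintype.card (Finset (Fin n)) : ℝ) with hN
    have hpos : 0 < N := by
      rw [hN]
      exact_mod_cast Fintype.card_pos
    have key : ∀ U : Finset (Fin n),
        lam U • mmap (chi U) = N⁻¹ • mmap ((N * lam U) • chi U) := fun U => by
      rw [mmap_smul_nonneg _ (mul_nonneg hpos.le (h0 U)), smul_smul,
        inv_mul_cancel_left₀ hpos.ne']
    rw [Finset.sum_congr rfl fun U _ => key U]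
    refine (convex_convexHull ℝ _).sum_mem (fun _ _ => (inv_pos.2 hpos).le) ?_
      (fun U _ => subset_convexHull ℝ _ ⟨_, rfl⟩)
    rw [Finset.sum_const, nsmul_eq_mul, Finset.card_univ]
    exact mul_inv_cancel₀ hpos.ne'
end

section
/- Let n ≥ 3 and let π be a permutation of [n]. Then R_n ∩ N_π = v^π + N_π, where v^π + N_π := {v^π + x : x ∈ N_π}. -/
open scoped BigOperators Pointwise

def Rn (n : ℕ) : Set (Fin n → ℝ) :=
  {x | (∑ k, x k) = 0 ∧ ∀ k l : Fin n, k ≠ l → 1 ≤ |x k - x l|}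

noncomputable def vpi {n : ℕ} (π : Equiv.Perm (Fin n)) : Fin n → ℝ :=
  fun j => permVec π j - ((n : ℝ) + 1) / 2

theorem sum_vpi {n : ℕ} (π : Equiv.Perm (Fin n)) : ∑ k, vpi π k = 0 := by
  have h1 : ∑ k, vpi π k = ∑ k : Fin n, (((k : ℕ) : ℝ) + 1 - ((n : ℝ) + 1) / 2) := by
    unfold vpi permVec
    exact Equiv.sum_comp π (fun k : Fin n => (((k : ℕ) : ℝ) + 1 - ((n : ℝ) + 1) / 2))
  have h2 : ∀ m : ℕ, ∑ k ∈ Finset.range m, ((k : ℝ) + 1) = m * (m + 1) / 2 := by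
    intro m
    induction m with
    | zero => simp
    | succ m ih => rw [Finset.sum_range_succ, ih]; push_cast; ring
  rw [h1, Finset.sum_sub_distrib, Fin.sum_univ_eq_sum_range (fun k => (k : ℝ) + 1) n, h2]
  simp
  ring

theorem gap_aux {n : ℕ} (π : Equiv.Perm (Fin n)) (x : Fin n → ℝ)
    (hR : ∀ k l : Fin n, k ≠ l → 1 ≤ |x k - x l|)
    (hN : ∀ k l : Fin n, π k < π l → x k ≤ x l) :
    ∀ (d : ℕ) (k l : Fin n), (π l : ℕ) = π k + d → (d : ℝ) ≤ x l - x k := by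
  intro d
  induction d with
  | zero =>
    intro k l h
    have : l = k := π.injective (Fin.ext (by simpa using h))
    subst this
    simp
  | succ d ih =>
    intro k l h
    have hlt : (π k : ℕ) + d < n := by have := (π l).isLt; omega
    have hm : π (π.symm ⟨(π k : ℕ) + d, hlt⟩) = ⟨(π k : ℕ) + d, hlt⟩ := π.apply_symm_apply _
    generalize π.symm ⟨(π k : ℕ) + d, hlt⟩ = m at hm
    have h1 := ih k m (by rw [hm])
    have hml : π m < π l := by rw [hm, Fin.lt_def]; simp only; omega
    have h2 := hN m l hml
    have h3 := hR l m (by rintro rfl; exact lt_irrefl _ hml)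
    rw [abs_of_nonneg (by linarith)] at h3
    push_cast
    linarith

theorem stmt4 (n : ℕ) (hn : 3 ≤ n) (π : Equiv.Perm (Fin n)) :
    Rn n ∩ Npi π = (fun x => vpi π + x) '' (Npi π) := by
  ext y
  constructor
  · rintro ⟨⟨-, hR⟩, hs, hN⟩
    refine ⟨y - vpi π, ⟨?_, ?_⟩, by simp⟩
    · simp [Finset.sum_sub_distrib, sum_vpi, hs]
    · intro k l hkl
      have hkl' : (π k : ℕ) < π l := hkl
      have h := gap_aux π y hR hN ((π l : ℕ) - π k) k l (by omega)
      rw [Nat.cast_sub hkl'.le] at h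
      simp only [Pi.sub_apply, vpi, permVec]
      linarith
  · rintro ⟨x, ⟨hs, hN⟩, rfl⟩
    have key : ∀ k l : Fin n, π k < π l → (vpi π + x) k + 1 ≤ (vpi π + x) l := by
      intro k l hkl
      have h1 := hN k l hkl
      have h2 : (((π k : ℕ) + 1 : ℕ) : ℝ) ≤ ((π l : ℕ) : ℝ) := Nat.cast_le.mpr hkl
      push_cast at h2
      simp only [Pi.add_apply, vpi, permVec]
      linarith
    have hsum : ∑ k, (vpi π + x) k = 0 := by
      simp [Finset.sum_add_distrib, sum_vpi, hs]
    refine ⟨⟨hsum, ?_⟩, hsum, ?_⟩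
    · intro k l hkl
      rcases lt_or_gt_of_ne (fun h => hkl (π.injective h)) with h | h
      · have := key k l h
        rw [le_abs]; right; simp only at *; linarith
      · have := key l k h
        rw [le_abs]; left; simp only at *; linarith
    · intro k l hkl
      have := key k l hkl
      simp only at *
      linarith
end

section
/- Let n ≥ 3. Then E^b_n = ⋃_{π ∈ S(n)} (M(π) + M(N_π)), where M(π) + M(N_π) := {M(π) + M(x) : x ∈ N_π}. Moreover, for permutations π, π′ of [n], the sets M(π) + M(N_π) and M(π′) + M(N_{π′}) are equal if π′ = π or π′ = π⁻, and they are disjoint otherwise. -/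
open scoped BigOperators Pointwise

noncomputable def coneAt {n : ℕ} (π : Equiv.Perm (Fin n)) : Set (Matrix (Fin n) (Fin n) ℝ) :=
  {X | ∃ x ∈ Npi π, X = Mperm π + mmap x}

theorem permVec_lt {n : ℕ} (π : Equiv.Perm (Fin n)) {k l : Fin n} (h : π k < π l) :
    permVec π k + 1 ≤ permVec π l := by
  have h1 : (π k : ℕ) + 1 ≤ (π l : ℕ) := h
  have h2 : (((π k : ℕ) + 1 : ℕ) : ℝ) ≤ ((π l : ℕ) : ℝ) := Nat.cast_le.mpr h1
  push_cast at h2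
  unfold permVec
  linarith

theorem cone_vec {n : ℕ} (π : Equiv.Perm (Fin n)) (x : Fin n → ℝ)
    (h : ∀ k l : Fin n, π k < π l → x k ≤ x l) :
    Mperm π + mmap x = mmap (permVec π + x) := by
  ext k l
  simp only [Matrix.add_apply, Mperm, mmap, Pi.add_apply]
  rcases lt_trichotomy (π k) (π l) with hh | hh | hh
  · have h1 := permVec_lt π hh
    have h2 := h k l hh
    rw [abs_of_nonpos (by linarith), abs_of_nonpos (by linarith), abs_of_nonpos (by linarith)]
    ring
  · have := π.injective hh
    subst this
    simp
  · have h1 := permVec_lt π hh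
    have h2 := h l k hh
    rw [abs_of_nonneg (by linarith), abs_of_nonneg (by linarith), abs_of_nonneg (by linarith)]
    ring

theorem mem_cone {n : ℕ} (π : Equiv.Perm (Fin n)) {X : Matrix (Fin n) (Fin n) ℝ}
    (h : X ∈ coneAt π) :
    ∃ y : Fin n → ℝ, X = mmap y ∧ ∀ k l : Fin n, π k < π l → y k + 1 ≤ y l := by
  obtain ⟨x, ⟨hx0, hx⟩, rfl⟩ := h
  refine ⟨permVec π + x, cone_vec π x hx, fun k l hkl => ?_⟩
  have h1 := permVec_lt π hkl
  have h2 := hx k l hkl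
  simp only [Pi.add_apply]
  linarith

theorem mmap_sub_const {n : ℕ} (y : Fin n → ℝ) (c : ℝ) : mmap (fun k => y k - c) = mmap y := by
  ext k l
  simp [mmap]

theorem mmap_neg {n : ℕ} (y : Fin n → ℝ) : mmap (fun k => - y k) = mmap y := by
  ext k l
  simp only [mmap]
  rw [← abs_neg]
  congr 1
  ring

theorem cone_of_order {n : ℕ} (hn : 0 < n) (π : Equiv.Perm (Fin n)) (y : Fin n → ℝ)
    (h : ∀ k l : Fin n, π k < π l → y k + 1 ≤ y l) : mmap y ∈ coneAt π := by
  have gap : ∀ (d : ℕ) (k l : Fin n), (π l : ℕ) = (π k : ℕ) + d → y k + d ≤ y l := by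
    intro d
    induction d with
    | zero =>
      intro k l hkl
      have : k = l := π.injective (Fin.ext (by omega))
      subst this
      simp
    | succ d ih =>
      intro k l hkl
      have hlt : (π k : ℕ) + d < n := by have := (π l).isLt; omega
      have h1 := ih k (π.symm ⟨(π k : ℕ) + d, hlt⟩) (by simp)
      have h2 := h (π.symm ⟨(π k : ℕ) + d, hlt⟩) l (by
        rw [Fin.lt_def]; simp; omega)
      push_cast
      linarith
  set c : ℝ := (∑ k, (y k - permVec π k)) / n with hc
  have hn' : (n : ℝ) ≠ 0 := by positivity
  have hord : ∀ k l : Fin n, π k < π l →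
      y k - permVec π k - c ≤ y l - permVec π l - c := by
    intro k l hkl
    have hle : (π k : ℕ) ≤ (π l : ℕ) := le_of_lt hkl
    have := gap ((π l : ℕ) - (π k : ℕ)) k l (by omega)
    rw [Nat.cast_sub hle] at this
    unfold permVec
    linarith
  refine ⟨fun k => y k - permVec π k - c, ⟨?_, hord⟩, ?_⟩
  · rw [Finset.sum_sub_distrib]
    simp only [Finset.sum_const, Finset.card_univ, Fintype.card_fin, nsmul_eq_mul]
    rw [hc]
    field_simp
    ring
  · rw [cone_vec π _ hord, ← mmap_sub_const y c]
    congr 1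
    ext k
    simp only [Pi.add_apply]
    ring

theorem antipode_lt {n : ℕ} (π : Equiv.Perm (Fin n)) (k l : Fin n) :
    antipode π k < antipode π l ↔ π l < π k := by
  simp [antipode]

theorem antipode_antipode {n : ℕ} (π : Equiv.Perm (Fin n)) : antipode (antipode π) = π := by
  ext k
  simp [antipode]

theorem cone_antipode_sub {n : ℕ} (hn : 0 < n) (π : Equiv.Perm (Fin n)) :
    coneAt π ⊆ coneAt (antipode π) := by
  intro X hX
  obtain ⟨y, rfl, hy⟩ := mem_cone π hX
  rw [← mmap_neg]
  apply cone_of_order hn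
  intro k l hkl
  have := hy l k ((antipode_lt π k l).1 hkl)
  linarith

theorem perm_eq_of_lt {n : ℕ} (π π' : Equiv.Perm (Fin n))
    (h : ∀ k l, π k < π l → π' k < π' l) : π' = π := by
  have hm : StrictMono (π.symm.trans π') := by
    intro i j hij
    apply h
    simpa using hij
  have h1 : ∀ i, (π.symm.trans π') i = i := by
    intro i
    have e : (hm.orderIsoOfSurjective _ (Equiv.surjective _)) = OrderIso.refl (Fin n) :=
      Subsingleton.elim _ _
    have := congrArg (fun f => f i) e
    simpa using this
  ext k
  have := h1 (π k)
  simp at this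
  rw [this]

theorem perm_eq_aux {n : ℕ} (π π' : Equiv.Perm (Fin n)) (y y' : Fin n → ℝ)
    (hy : ∀ k l : Fin n, π k < π l → y k + 1 ≤ y l)
    (hy' : ∀ k l : Fin n, π' k < π' l → y' k + 1 ≤ y' l)
    (e : ∀ k l, |y k - y l| = |y' k - y' l|) (a b : Fin n)
    (ha : ∀ k, y a ≤ y k) (hb : ∀ k, y k ≤ y b) (hab : y' a ≤ y' b) : π' = π := by
  have key : ∀ k, y' k - y' a = y k - y a := by
    intro k
    have e1 := e k a
    have e2 := e b k
    have e3 := e b a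
    rw [abs_of_nonneg (by linarith [ha k])] at e1
    rw [abs_of_nonneg (by linarith [hb k])] at e2
    rw [abs_of_nonneg (by linarith [ha b]), abs_of_nonneg (by linarith)] at e3
    have h3 := le_abs_self (y' b - y' k)
    have h4 := le_abs_self (y' k - y' a)
    linarith
  apply perm_eq_of_lt
  intro k l hkl
  have h1 := hy k l hkl
  by_contra hcon
  rcases (not_lt.1 hcon).lt_or_eq with h2 | h2
  · have := hy' l k h2
    linarith [key k, key l]
  · have := π'.injective h2
    subst this
    exact lt_irrefl _ hkl

theorem perm_eq {n : ℕ} (hn : 0 < n) (π π' : Equiv.Perm (Fin n)) (y y' : Fin n → ℝ)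
    (hy : ∀ k l : Fin n, π k < π l → y k + 1 ≤ y l)
    (hy' : ∀ k l : Fin n, π' k < π' l → y' k + 1 ≤ y' l)
    (e : mmap y = mmap y') : π' = π ∨ π' = antipode π := by
  haveI : Nonempty (Fin n) := ⟨⟨0, hn⟩⟩
  obtain ⟨a, ha⟩ := Finite.exists_min y
  obtain ⟨b, hb⟩ := Finite.exists_max y
  have e' : ∀ k l, |y k - y l| = |y' k - y' l| := fun k l => congrFun (congrFun e k) l
  rcases le_total (y' a) (y' b) with h | h
  · exact Or.inl (perm_eq_aux π π' y y' hy hy' e' a b ha hb h)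
  · right
    have := perm_eq_aux π (antipode π') y (fun k => - y' k) hy
      (fun k l hkl => by
        have := hy' l k ((antipode_lt π' k l).1 hkl)
        linarith)
      (fun k l => by
        rw [e' k l]
        exact (congrFun (congrFun (mmap_neg y') k) l).symm) a b ha hb (by linarith)
    rw [← this, antipode_antipode]

theorem stmt5 (n : ℕ) (hn : 3 ≤ n) :
    (Ebn n = ⋃ π : Equiv.Perm (Fin n), coneAt π) ∧
    ∀ π π' : Equiv.Perm (Fin n),
      ((π' = π ∨ π' = antipode π) → coneAt π' = coneAt π) ∧
      ((π' ≠ π ∧ π' ≠ antipode π) → Disjoint (coneAt π) (coneAt π')) := by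
  have hn0 : 0 < n := by omega
  have hanti : ∀ π : Equiv.Perm (Fin n), coneAt (antipode π) = coneAt π := by
    intro π
    apply Set.Subset.antisymm
    · have := cone_antipode_sub hn0 (antipode π)
      rwa [antipode_antipode] at this
    · exact cone_antipode_sub hn0 π
  refine ⟨?_, fun π π' => ⟨?_, ?_⟩⟩
  · ext X
    simp only [Set.mem_iUnion]
    constructor
    · rintro ⟨x, hx, rfl⟩
      refine ⟨(Tuple.sort x).symm, cone_of_order hn0 _ x ?_⟩
      intro k l hkl
      have hm := Tuple.monotone_sort x hkl.le
      simp only [Function.comp_apply, Equiv.apply_symm_apply] at hm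
      have hne : k ≠ l := by
        rintro rfl
        exact lt_irrefl _ hkl
      have := hx k l hne
      rw [abs_of_nonpos (by linarith)] at this
      linarith
    · rintro ⟨π, hX⟩
      obtain ⟨y, rfl, hy⟩ := mem_cone π hX
      refine ⟨y, fun k l hkl => ?_, rfl⟩
      rcases lt_or_gt_of_ne (fun h => hkl (π.injective h)) with h | h
      · have := hy k l h
        rw [abs_of_nonpos (by linarith)]
        linarith
      · have := hy l k h
        rw [abs_of_nonneg (by linarith)]
        linarith
  · rintro (rfl | rfl)
    · rfl
    · exact hanti π
  · rintro ⟨h1, h2⟩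
    rw [Set.disjoint_left]
    intro X hX hX'
    obtain ⟨y, rfl, hy⟩ := mem_cone π hX
    obtain ⟨y', e, hy'⟩ := mem_cone π' hX'
    rcases perm_eq hn0 π π' y y' hy hy' e with h | h
    · exact h1 h
    · exact h2 h
end

section
/- Let n ≥ 3. Then Q_n, the convex hull of E^b_n, equals the convex hull of the union of all half-lines M(π) + ℝ≥0·M(χ^U) = {M(π) + t·M(χ^U) : t ≥ 0}, taken over all permutations π of [n] and all nonempty proper subsets U ⊊ [n] incident to π. -/
open scoped BigOperators Pointwise

lemma mmap_apply' {n : ℕ} (x : Fin n → ℝ) (k l : Fin n) : mmap x k l = |x k - x l| := rfl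

lemma mem_Ebn_of_halfline {n : ℕ} {π : Equiv.Perm (Fin n)} {U : Finset (Fin n)}
    (h : incident π U) {X : Matrix (Fin n) (Fin n) ℝ} (hX : X ∈ halfline π U) : X ∈ Ebn n := by
  obtain ⟨t, ht, rfl⟩ := hX
  obtain ⟨-, -, hU⟩ := h
  have key : ∀ k l : Fin n, π k < π l →
      (permVec π k - t * chi U k) - (permVec π l - t * chi U l) =
        -((permVec π l - permVec π k) + t * (chi U k - chi U l)) ∧
      0 ≤ chi U k - chi U l ∧ 1 ≤ permVec π l - permVec π k := by
    intro k l hkl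
    refine ⟨by ring, ?_, ?_⟩
    · have hkl' : (π k : ℕ) < π l := hkl
      unfold chi
      by_cases hl : l ∈ U
      · have hk : k ∈ U := by
          rw [hU] at hl ⊢
          omega
        simp [hl, hk]
      · by_cases hk : k ∈ U <;> simp [hl, hk]
    · have hkl' : (π k : ℕ) + 1 ≤ π l := hkl
      have : ((π k : ℕ) : ℝ) + 1 ≤ ((π l : ℕ) : ℝ) := by exact_mod_cast hkl'
      unfold permVec
      linarith
  refine ⟨fun j => permVec π j - t * chi U j, ?_, ?_⟩
  · intro k l hkl
    rcases lt_or_gt_of_ne (fun h => hkl (π.injective h)) with h | h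
    · obtain ⟨h1, h2, h3⟩ := key k l h
      rw [h1, abs_neg]
      have := mul_nonneg ht h2
      exact le_trans (by linarith) (le_abs_self _)
    · obtain ⟨h1, h2, h3⟩ := key l k h
      rw [abs_sub_comm, h1, abs_neg]
      have := mul_nonneg ht h2
      exact le_trans (by linarith) (le_abs_self _)
  · ext k l
    simp only [Matrix.add_apply, Matrix.smul_apply, mmap_apply', Mperm, smul_eq_mul]
    rcases lt_trichotomy (π k) (π l) with h | h | h
    · obtain ⟨h1, h2, h3⟩ := key k l h
      have := mul_nonneg ht h2
      rw [h1, abs_neg, abs_sub_comm (permVec π k), abs_of_nonneg h2,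
        abs_of_nonneg (by linarith : 0 ≤ permVec π l - permVec π k), abs_of_nonneg (by linarith)]
    · have := π.injective h
      subst this
      simp
    · obtain ⟨h1, h2, h3⟩ := key l k h
      have := mul_nonneg ht h2
      rw [abs_sub_comm (permVec π k - _), h1, abs_neg, abs_sub_comm (chi U k), abs_of_nonneg h2,
        abs_of_nonneg (by linarith : 0 ≤ permVec π k - permVec π l), abs_of_nonneg (by linarith)]

/-- The initial segment of `π` with `i + 1` elements. -/
def seg {n : ℕ} (π : Equiv.Perm (Fin n)) (i : ℕ) : Finset (Fin n) :=
  Finset.univ.filter fun j => (π j : ℕ) ≤ i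

lemma mem_seg {n : ℕ} (π : Equiv.Perm (Fin n)) (i : ℕ) (j : Fin n) :
    j ∈ seg π i ↔ (π j : ℕ) ≤ i := by simp [seg]

lemma card_seg {n : ℕ} (π : Equiv.Perm (Fin n)) (i : ℕ) (hi : i + 1 < n) :
    (seg π i).card = i + 1 := by
  have h : (seg π i).map π.toEmbedding = Finset.Iic (⟨i, by omega⟩ : Fin n) := by
    ext j
    simp only [Finset.mem_map_equiv, mem_seg, Equiv.apply_symm_apply, Finset.mem_Iic]
    rfl
  rw [← Finset.card_map π.toEmbedding, h, Fin.card_Iic]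

lemma incident_seg {n : ℕ} (π : Equiv.Perm (Fin n)) (i : ℕ) (hi : i + 1 < n) :
    incident π (seg π i) := by
  refine ⟨?_, ?_, ?_⟩
  · rw [← Finset.card_pos, card_seg π i hi]; omega
  · intro h
    have := card_seg π i hi
    rw [h, Finset.card_univ, Fintype.card_fin] at this
    omega
  · intro j
    rw [card_seg π i hi, mem_seg]; omega

lemma exists_decomp {n : ℕ} (x : Fin n → ℝ) (hx : ∀ k l : Fin n, k ≠ l → 1 ≤ |x k - x l|) :
    ∃ (π : Equiv.Perm (Fin n)) (s : ℕ → ℝ), (∀ i ∈ Finset.range (n - 1), 0 ≤ s i) ∧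
      mmap x = Mperm π + ∑ i ∈ Finset.range (n - 1), s i • mmap (chi (seg π i)) := by
  set σ := Tuple.sort x with hσ
  have hmono : Monotone (x ∘ σ) := Tuple.monotone_sort x
  let z : ℕ → ℝ := fun i => if h : i < n then x (σ ⟨i, h⟩) else 0
  let s : ℕ → ℝ := fun i => z (i + 1) - z i - 1
  have hz : ∀ j : Fin n, z (σ.symm j) = x j := by
    intro j
    simp [z]
  have hs : ∀ i ∈ Finset.range (n - 1), 0 ≤ s i := by
    intro i hi
    rw [Finset.mem_range] at hi
    have h1 : i < n := by omega
    have h2 : i + 1 < n := by omega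
    have h3 : x (σ ⟨i, h1⟩) ≤ x (σ ⟨i + 1, h2⟩) :=
      hmono (show (⟨i, h1⟩ : Fin n) ≤ ⟨i + 1, h2⟩ from Nat.le_succ i)
    have h4 := hx (σ ⟨i + 1, h2⟩) (σ ⟨i, h1⟩) (by
      intro h
      have := congrArg Fin.val (σ.injective h)
      simp at this)
    rw [abs_of_nonneg (by linarith)] at h4
    simp only [s, z, h1, h2, dif_pos]
    linarith
  have hx' : ∀ j : Fin n, x j = z 0 + ((σ.symm j : ℕ) : ℝ) +
      ∑ i ∈ Finset.range (n - 1), s i * (1 - chi (seg σ.symm i) j) := by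
    intro j
    have hj : (σ.symm j : ℕ) ≤ n - 1 := by omega
    have e1 : ∑ i ∈ Finset.range (n - 1), s i * (1 - chi (seg σ.symm i) j)
        = ∑ i ∈ Finset.range (σ.symm j : ℕ), s i := by
      symm
      rw [← Finset.sum_subset (Finset.range_subset_range.2 hj)]
      · refine Finset.sum_congr rfl fun i hi => ?_
        have : ¬ (σ.symm j : ℕ) ≤ i := by simpa using hi
        simp [chi, mem_seg, this]
      · intro i _ hi
        have : (σ.symm j : ℕ) ≤ i := by simpa using hi
        simp [chi, mem_seg, this]
    rw [e1]
    simp only [s]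
    rw [Finset.sum_sub_distrib, Finset.sum_range_sub, hz]
    simp
  have key : ∀ k l : Fin n, σ.symm k ≤ σ.symm l → mmap x k l =
      (Mperm σ.symm + ∑ i ∈ Finset.range (n - 1), s i • mmap (chi (seg σ.symm i))) k l := by
    intro k l hkl
    have hle : ((σ.symm k : ℕ) : ℝ) ≤ ((σ.symm l : ℕ) : ℝ) := by exact_mod_cast hkl
    have hc : ∀ i, 0 ≤ chi (seg σ.symm i) k - chi (seg σ.symm i) l := by
      intro i
      have hkl' : (σ.symm k : ℕ) ≤ σ.symm l := hkl
      by_cases h1 : (σ.symm k : ℕ) ≤ i <;> by_cases h2 : (σ.symm l : ℕ) ≤ i <;>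
        simp [chi, mem_seg, h1, h2]
      omega
    have e2 : x l - x k = (((σ.symm l : ℕ) : ℝ) - ((σ.symm k : ℕ) : ℝ)) +
        ∑ i ∈ Finset.range (n - 1), s i * (chi (seg σ.symm i) k - chi (seg σ.symm i) l) := by
      have : ∑ i ∈ Finset.range (n - 1), s i * (chi (seg σ.symm i) k - chi (seg σ.symm i) l)
        = ∑ i ∈ Finset.range (n - 1), s i * (1 - chi (seg σ.symm i) l)
          - ∑ i ∈ Finset.range (n - 1), s i * (1 - chi (seg σ.symm i) k) := by
        rw [← Finset.sum_sub_distrib]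
        exact Finset.sum_congr rfl fun i _ => by ring
      rw [hx' l, hx' k, this]
      ring
    have hnn : 0 ≤ ∑ i ∈ Finset.range (n - 1),
        s i * (chi (seg σ.symm i) k - chi (seg σ.symm i) l) :=
      Finset.sum_nonneg fun i hi => mul_nonneg (hs i hi) (hc i)
    simp only [Matrix.add_apply, Matrix.sum_apply, Matrix.smul_apply, mmap_apply', Mperm,
      smul_eq_mul, abs_of_nonneg (hc _)]
    rw [abs_sub_comm, e2, abs_of_nonneg (by linarith), abs_sub_comm (permVec _ _)]
    congr 1
    rw [abs_of_nonneg] <;> simp only [permVec] <;> linarith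
  refine ⟨σ.symm, s, hs, ?_⟩
  ext k l
  rcases le_total (σ.symm k) (σ.symm l) with h | h
  · exact key k l h
  · have h1 := key l k h
    simp only [Matrix.add_apply, Matrix.sum_apply, Matrix.smul_apply, mmap_apply', Mperm] at h1 ⊢
    rw [abs_sub_comm, h1, abs_sub_comm (permVec _ _)]
    congr 1
    exact Finset.sum_congr rfl fun i _ => by rw [abs_sub_comm]

theorem stmt6 (n : ℕ) (hn : 3 ≤ n) :
    Qn n = convexHull ℝ
      {X | ∃ π : Equiv.Perm (Fin n), ∃ U : Finset (Fin n), incident π U ∧ X ∈ halfline π U} := by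
  apply Set.Subset.antisymm
  · refine convexHull_min ?_ (convex_convexHull ℝ _)
    rintro X ⟨x, hx, rfl⟩
    obtain ⟨π, s, hs, h⟩ := exists_decomp x hx
    have hm : (0 : ℝ) < ((n - 1 : ℕ) : ℝ) := by
      have : 0 < n - 1 := by omega
      exact_mod_cast this
    have h2 : mmap x = ∑ i ∈ Finset.range (n - 1), (((n - 1 : ℕ) : ℝ))⁻¹ •
        (Mperm π + ((((n - 1 : ℕ) : ℝ)) * s i) • mmap (chi (seg π i))) := by
      rw [h]
      simp only [smul_add, Finset.sum_add_distrib, Finset.sum_const, Finset.card_range, smul_smul]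
      congr 1
      · rw [← Nat.cast_smul_eq_nsmul ℝ, smul_smul, mul_inv_cancel₀ hm.ne', one_smul]
      · refine Finset.sum_congr rfl fun i _ => ?_
        rw [inv_mul_cancel_left₀ hm.ne']
    rw [h2]
    refine (convex_convexHull ℝ _).sum_mem (fun i _ => by positivity) ?_ ?_
    · rw [Finset.sum_const, Finset.card_range, nsmul_eq_mul, mul_inv_cancel₀ hm.ne']
    · intro i hi
      apply subset_convexHull
      refine ⟨π, seg π i, incident_seg π i ?_, _, mul_nonneg hm.le (hs i hi), rfl⟩
      have := Finset.mem_range.1 hi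
      omega
  · refine convexHull_mono ?_
    rintro X ⟨π, U, hU, hX⟩
    exact mem_Ebn_of_halfline hU hX
end

section
/- Let n ≥ 3. Then for every X ∈ Q_n one has ∑_{k≠l} X_{k,l} ≥ n(n+1)(n−1)/3, and the set of points of Q_n attaining equality is exactly P_n, i.e., {X ∈ Q_n : ∑_{k≠l} X_{k,l} = n(n+1)(n−1)/3} = P_n. In particular, P_n is an exposed subset of Q_n. -/
open scoped BigOperators Pointwise

noncomputable def fsum8 (n : ℕ) : Matrix (Fin n) (Fin n) ℝ →ₗ[ℝ] ℝ where
  toFun X := ∑ k, ∑ l, if k = l then 0 else X k l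
  map_add' X Y := by
    simp only [← Finset.sum_add_distrib]
    refine Finset.sum_congr rfl fun k _ => Finset.sum_congr rfl fun l _ => ?_
    split_ifs <;> simp
  map_smul' c X := by
    simp only [Finset.smul_sum, RingHom.id_apply]
    refine Finset.sum_congr rfl fun k _ => Finset.sum_congr rfl fun l _ => ?_
    split_ifs <;> simp

theorem fsum8_mmap {n : ℕ} (x : Fin n → ℝ) :
    fsum8 n (mmap x) = ∑ k, ∑ l, |x k - x l| := by
  change (∑ k, ∑ l, if k = l then 0 else mmap x k l) = _
  refine Finset.sum_congr rfl fun k _ => Finset.sum_congr rfl fun l _ => ?_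
  split_ifs with h
  · simp [h]
  · rfl

theorem sum_last8 (n : ℕ) :
    ∑ i ∈ Finset.range n, |(i : ℝ) - n| = (n : ℝ) * (n + 1) / 2 := by
  have h : ∑ i ∈ Finset.range n, |(i : ℝ) - n| = ∑ i ∈ Finset.range n, ((n : ℝ) - i) := by
    refine Finset.sum_congr rfl fun i hi => ?_
    have : (i : ℝ) ≤ n := by exact_mod_cast (Finset.mem_range.1 hi).le
    rw [abs_sub_comm, abs_of_nonneg (by linarith)]
  have h2 : ∀ m : ℕ, ∑ i ∈ Finset.range m, (i : ℝ) = (m : ℝ) * (m - 1) / 2 := by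
    intro m
    induction m with
    | zero => simp
    | succ m ih => rw [Finset.sum_range_succ, ih]; push_cast; ring
  rw [h, Finset.sum_sub_distrib, h2]
  simp
  ring

theorem sum_range8 (n : ℕ) :
    ∑ i ∈ Finset.range n, ∑ j ∈ Finset.range n, |(i : ℝ) - j|
      = ((n : ℝ) * ((n : ℝ) + 1) * ((n : ℝ) - 1)) / 3 := by
  induction n with
  | zero => simp
  | succ n ih =>
    rw [Finset.sum_range_succ]
    simp only [Finset.sum_range_succ _ n]
    rw [Finset.sum_add_distrib, ih, sum_last8]
    have : ∑ j ∈ Finset.range n, |(n : ℝ) - j| = (n : ℝ) * (n + 1) / 2 := by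
      rw [← sum_last8]
      exact Finset.sum_congr rfl fun i _ => abs_sub_comm _ _
    rw [this]
    simp
    ring

theorem fsum8_Mperm {n : ℕ} (π : Equiv.Perm (Fin n)) :
    fsum8 n (Mperm π) = ((n : ℝ) * ((n : ℝ) + 1) * ((n : ℝ) - 1)) / 3 := by
  rw [Mperm, fsum8_mmap, ← sum_range8]
  simp only [permVec, add_sub_add_right_eq_sub]
  rw [Equiv.sum_comp π (fun k => ∑ l, |((k : ℕ) : ℝ) - ((π l : ℕ) : ℝ)|)]
  rw [← Fin.sum_univ_eq_sum_range (fun i => ∑ j ∈ Finset.range n, |(i : ℝ) - j|)]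
  refine Finset.sum_congr rfl fun k _ => ?_
  rw [Equiv.sum_comp π (fun l => |((k : ℕ) : ℝ) - ((l : ℕ) : ℝ)|)]
  rw [← Fin.sum_univ_eq_sum_range (fun j => |((k : ℕ) : ℝ) - (j : ℝ)|)]

theorem gap8 {n : ℕ} (y : Fin n → ℝ) (hm : Monotone y)
    (hy : ∀ k l : Fin n, k ≠ l → 1 ≤ |y k - y l|) :
    ∀ (d i : ℕ) (h : i + d < n), (d : ℝ) ≤ y ⟨i + d, h⟩ - y ⟨i, by omega⟩ := by
  intro d
  induction d with
  | zero => intro i h; simp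
  | succ d ih =>
    intro i h
    have h1 := ih i (by omega)
    have h2 := hy ⟨i + (d + 1), h⟩ ⟨i + d, by omega⟩ (by simp)
    have h3 : y ⟨i + d, by omega⟩ ≤ y ⟨i + (d + 1), h⟩ := hm (by simp)
    rw [abs_of_nonneg (by linarith)] at h2
    push_cast
    linarith

theorem exists_perm8 {n : ℕ} (x : Fin n → ℝ)
    (hx : ∀ k l : Fin n, k ≠ l → 1 ≤ |x k - x l|) :
    ∃ π : Equiv.Perm (Fin n), ∀ k l, Mperm π k l ≤ mmap x k l := by
  have key : ∀ i j : Fin n, |((i : ℕ) : ℝ) - ((j : ℕ) : ℝ)| ≤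
      |x (Tuple.sort x i) - x (Tuple.sort x j)| := by
    have g := gap8 (x ∘ Tuple.sort x) (Tuple.monotone_sort x)
      (fun k l h => hx _ _ (fun e => h ((Tuple.sort x).injective e)))
    have w : ∀ i j : Fin n, i ≤ j → |((i : ℕ) : ℝ) - ((j : ℕ) : ℝ)| ≤
        |x (Tuple.sort x i) - x (Tuple.sort x j)| := by
      intro i j hij
      obtain ⟨d, hd⟩ := Nat.exists_eq_add_of_le (Fin.le_def.1 hij)
      have h1 := g d i (by omega)
      have e : (⟨(i : ℕ) + d, by omega⟩ : Fin n) = j := Fin.ext hd.symm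
      rw [e] at h1
      simp only [Function.comp] at h1
      rw [hd, abs_sub_comm, abs_sub_comm (x _)]
      push_cast
      rw [add_sub_cancel_left, abs_of_nonneg (Nat.cast_nonneg d)]
      exact h1.trans (le_abs_self _)
    intro i j
    rcases le_total i j with h | h
    · exact w i j h
    · rw [abs_sub_comm, abs_sub_comm (x _)]
      exact w j i h
  refine ⟨(Tuple.sort x).symm, fun k l => ?_⟩
  have := key ((Tuple.sort x).symm k) ((Tuple.sort x).symm l)
  simpa [Mperm, mmap, permVec] using this

theorem Mperm_mem8 {n : ℕ} (π : Equiv.Perm (Fin n)) : Mperm π ∈ Ebn n := by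
  refine ⟨permVec π, fun k l h => ?_, rfl⟩
  have h1 : ((π k : ℕ) : ℤ) - ((π l : ℕ) : ℤ) ≠ 0 := by
    intro e
    apply h
    apply π.injective
    apply Fin.ext
    omega
  have h2 := Int.one_le_abs h1
  simp only [permVec, add_sub_add_right_eq_sub]
  exact_mod_cast h2

theorem Ebn8 {n : ℕ} {X : Matrix (Fin n) (Fin n) ℝ} (hX : X ∈ Ebn n) :
    ((n : ℝ) * ((n : ℝ) + 1) * ((n : ℝ) - 1)) / 3 ≤ fsum8 n X ∧
    (fsum8 n X = ((n : ℝ) * ((n : ℝ) + 1) * ((n : ℝ) - 1)) / 3 → X ∈ Pn n) := by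
  obtain ⟨x, hx, rfl⟩ := hX
  obtain ⟨π, hπ⟩ := exists_perm8 x hx
  rw [← fsum8_Mperm π, fsum8_mmap, Mperm, fsum8_mmap]
  refine ⟨Finset.sum_le_sum fun k _ => Finset.sum_le_sum fun l _ => hπ k l, fun h => ?_⟩
  apply subset_convexHull
  refine ⟨π, ?_⟩
  have h1 := (Finset.sum_eq_sum_iff_of_le
    (fun k _ => Finset.sum_le_sum fun l _ => hπ k l)).1 h.symm
  ext k l
  have h2 := (Finset.sum_eq_sum_iff_of_le (fun l _ => hπ k l)).1 (h1 k (Finset.mem_univ _))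
  exact (h2 l (Finset.mem_univ _)).symm

theorem Qn8 {n : ℕ} {X : Matrix (Fin n) (Fin n) ℝ} (hX : X ∈ Qn n) :
    ((n : ℝ) * ((n : ℝ) + 1) * ((n : ℝ) - 1)) / 3 ≤ fsum8 n X ∧
    (fsum8 n X = ((n : ℝ) * ((n : ℝ) + 1) * ((n : ℝ) - 1)) / 3 → X ∈ Pn n) := by
  generalize hc : ((n : ℝ) * ((n : ℝ) + 1) * ((n : ℝ) - 1)) / 3 = c
  have hsub : Ebn n ⊆ {X | c ≤ fsum8 n X ∧ (fsum8 n X = c → X ∈ Pn n)} := by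
    intro Y hY
    have := Ebn8 hY
    rw [hc] at this
    exact this
  refine convexHull_min hsub ?_ hX
  rintro Y ⟨hY, hY'⟩ Z ⟨hZ, hZ'⟩ a b ha hb hab
  have h1 := mul_le_mul_of_nonneg_left hY ha
  have h2 := mul_le_mul_of_nonneg_left hZ hb
  have h3 : a * c + b * c = c := by rw [← add_mul, hab, one_mul]
  simp only [Set.mem_ofPred_eq, map_add, map_smul, smul_eq_mul]
  refine ⟨by linarith, fun h => ?_⟩
  rcases ha.eq_or_lt with rfl | ha'
  · obtain rfl : b = 1 := by linarith
    simpa using hZ' (by linarith)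
  rcases hb.eq_or_lt with rfl | hb'
  · obtain rfl : a = 1 := by linarith
    simpa using hY' (by linarith)
  refine convex_convexHull ℝ _ (hY' ?_) (hZ' ?_) ha hb hab
  · exact mul_left_cancel₀ ha'.ne' (by linarith : a * fsum8 n Y = a * c)
  · exact mul_left_cancel₀ hb'.ne' (by linarith : b * fsum8 n Z = b * c)

theorem Pn8 {n : ℕ} {X : Matrix (Fin n) (Fin n) ℝ} (hX : X ∈ Pn n) :
    X ∈ Qn n ∧ fsum8 n X = ((n : ℝ) * ((n : ℝ) + 1) * ((n : ℝ) - 1)) / 3 := by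
  constructor
  · refine convexHull_mono ?_ hX
    rintro _ ⟨π, rfl⟩
    exact Mperm_mem8 π
  · have hconv : Convex ℝ {X | fsum8 n X = ((n : ℝ) * ((n : ℝ) + 1) * ((n : ℝ) - 1)) / 3} :=
      convex_hyperplane (fsum8 n).isLinear _
    refine convexHull_min ?_ hconv hX
    rintro _ ⟨π, rfl⟩
    exact fsum8_Mperm π

theorem face8 (n : ℕ) : {X ∈ Qn n | fsum8 n X
        = ((n : ℝ) * ((n : ℝ) + 1) * ((n : ℝ) - 1)) / 3} = Pn n :=
  Set.ext fun _ => ⟨fun h => (Qn8 h.1).2 h.2, fun h => Pn8 h⟩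

theorem stmt8 (n : ℕ) (hn : 3 ≤ n) :
    (∀ X ∈ Qn n,
        ((n : ℝ) * ((n : ℝ) + 1) * ((n : ℝ) - 1)) / 3 ≤ ∑ k, ∑ l, if k = l then 0 else X k l) ∧
    {X ∈ Qn n | (∑ k, ∑ l, if k = l then 0 else X k l)
        = ((n : ℝ) * ((n : ℝ) + 1) * ((n : ℝ) - 1)) / 3} = Pn n ∧
    ∃ f : Matrix (Fin n) (Fin n) ℝ →ₗ[ℝ] ℝ, ∃ c : ℝ,
      (∀ X ∈ Qn n, c ≤ f X) ∧ {X ∈ Qn n | f X = c} = Pn n := by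
  exact ⟨fun X hX => (Qn8 hX).1, face8 n, fsum8 n, _, fun X hX => (Qn8 hX).1, face8 n⟩
end

section
/- Let n ≥ 3, let π be a permutation of [n], and let 𝒲 be any family of nonempty proper subsets of [n], each incident to π. Then the set M(π) + {∑_{U ∈ 𝒲} λ_U · M(χ^U) : λ_U ≥ 0} is an exposed subset of Q_n. In particular, for each π the simplicial cone M(π) + M(N_π) and each of the half-lines M(π) + ℝ≥0·M(χ^U) with U incident to π are exposed subsets of Q_n. -/
open scoped BigOperators Pointwise

/-- The initial segment of `π` consisting of the elements in positions `0, …, i`. -/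
def preU {m : ℕ} (π : Equiv.Perm (Fin (m+1))) (i : ℕ) : Finset (Fin (m+1)) :=
  Finset.univ.filter (fun j => (π j : ℕ) ≤ i)

/-- The element in position `i` of `π`. -/
def posn {m : ℕ} (π : Equiv.Perm (Fin (m+1))) (i : ℕ) : Fin (m+1) :=
  π.symm (Fin.ofNat (m+1) i)

lemma pi_posn {m : ℕ} (π : Equiv.Perm (Fin (m+1))) (i : ℕ) (hi : i ≤ m) :
    ((π (posn π i) : Fin (m+1)) : ℕ) = i := by
  simp [posn, Nat.mod_eq_of_lt (Nat.lt_succ_of_le hi)]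

lemma posn_pi {m : ℕ} (π : Equiv.Perm (Fin (m+1))) (k : Fin (m+1)) :
    posn π (π k : ℕ) = k := by
  simp [posn]

lemma incident_pre {m : ℕ} (π : Equiv.Perm (Fin (m+1))) (U : Finset (Fin (m+1)))
    (h : incident π U) : ∃ i < m, U = preU π i := by
  obtain ⟨h1, h2, h3⟩ := h
  have hc : 0 < U.card := Finset.card_pos.mpr h1
  have hlt : U.card < m + 1 := by
    have := (Finset.card_lt_iff_ne_univ U).mpr h2
    simpa using this
  refine ⟨U.card - 1, by omega, ?_⟩
  ext j
  rw [h3 j]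
  simp only [preU, Finset.mem_filter, Finset.mem_univ, true_and]
  omega

/-- The family of the frozen statement. -/
def faceSet {n : ℕ} (π : Equiv.Perm (Fin n)) (W : Set (Finset (Fin n))) :
    Set (Matrix (Fin n) (Fin n) ℝ) :=
  {X | ∃ lam : Finset (Fin n) → ℝ, (∀ U, 0 ≤ lam U) ∧ (∀ U, lam U ≠ 0 → U ∈ W) ∧
          X = Mperm π + ∑ U : Finset (Fin n), lam U • mmap (chi U)}

lemma faceSet_convex {n : ℕ} (π : Equiv.Perm (Fin n)) (W : Set (Finset (Fin n))) :
    Convex ℝ (faceSet π W) := by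
  rintro X ⟨l1, h1, h1', rfl⟩ Y ⟨l2, h2, h2', rfl⟩ a b ha hb hab
  refine ⟨fun U => a * l1 U + b * l2 U, fun U => ?_, fun U hU => ?_, ?_⟩
  · have := h1 U; have := h2 U; positivity
  · by_contra hn
    have e1 : l1 U = 0 := by by_contra h; exact hn (h1' U h)
    have e2 : l2 U = 0 := by by_contra h; exact hn (h2' U h)
    exact hU (by simp [e1, e2])
  · simp only [add_smul, mul_smul, Finset.sum_add_distrib, ← Finset.smul_sum, smul_add]
    have : Mperm π = a • Mperm π + b • Mperm π := by rw [← add_smul, hab, one_smul]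
    nth_rewrite 3 [this]
    abel

lemma mperm_apply {n : ℕ} (π : Equiv.Perm (Fin n)) (k l : Fin n) :
    Mperm π k l = |((π k : ℕ) : ℝ) - ((π l : ℕ) : ℝ)| := by
  simp [Mperm, mmap, permVec]

lemma sum_apply2 {n : ℕ} {ι : Type*} (s : Finset ι) (c : ι → ℝ) (A : ι → Matrix (Fin n) (Fin n) ℝ)
    (k l : Fin n) : (∑ i ∈ s, c i • A i) k l = ∑ i ∈ s, c i * A i k l := by
  simp [Matrix.sum_apply]

lemma ico_tele (y : ℕ → ℝ) (a b : ℕ) (h : a ≤ b) :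
    ∑ i ∈ Finset.Ico a b, (y (i+1) - y i) = y b - y a := Finset.sum_Ico_sub y h

lemma chi_pre {m : ℕ} (π : Equiv.Perm (Fin (m+1))) (i : ℕ) (k l : Fin (m+1)) (h : π k ≤ π l) :
    mmap (chi (preU π i)) k l = if i ∈ Finset.Ico (π k : ℕ) (π l : ℕ) then 1 else 0 := by
  have h' : (π k : ℕ) ≤ π l := h
  simp only [mmap, chi, preU, Finset.mem_filter, Finset.mem_univ, true_and, Finset.mem_Ico]
  split_ifs <;> first | omega | simp

/-- Decomposition of a monotone vector. -/
lemma mono_decomp {m : ℕ} (π : Equiv.Perm (Fin (m+1))) (z : Fin (m+1) → ℝ)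
    (hz : ∀ i < m, 0 ≤ z (posn π (i+1)) - z (posn π i)) :
    mmap z = Mperm π + ∑ i ∈ Finset.range m,
      (z (posn π (i+1)) - z (posn π i) - 1) • mmap (chi (preU π i)) := by
  have key : ∀ k l : Fin (m+1), π k ≤ π l → mmap z k l = (Mperm π + ∑ i ∈ Finset.range m,
      (z (posn π (i+1)) - z (posn π i) - 1) • mmap (chi (preU π i))) k l := by
    intro k l h
    have h' : (π k : ℕ) ≤ π l := h
    have hl : (π l : ℕ) < m + 1 := (π l).2
    rw [Matrix.add_apply, sum_apply2, mperm_apply]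
    simp only [chi_pre π _ k l h, mul_ite, mul_one, mul_zero]
    rw [← Finset.sum_filter]
    have hf : (Finset.range m).filter (fun i => i ∈ Finset.Ico (π k : ℕ) (π l : ℕ))
        = Finset.Ico (π k : ℕ) (π l : ℕ) := by
      ext i; simp only [Finset.mem_filter, Finset.mem_range, Finset.mem_Ico]; omega
    have ht := ico_tele (fun i => z (posn π i)) _ _ h'
    simp only [posn_pi] at ht
    have hpos : 0 ≤ z l - z k := by
      rw [← ht]
      apply Finset.sum_nonneg
      intro i hi
      rw [Finset.mem_Ico] at hi
      exact hz i (by omega)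
    rw [hf, Finset.sum_sub_distrib, ht]
    have hc : ((π k : ℕ) : ℝ) ≤ ((π l : ℕ) : ℝ) := by exact_mod_cast h'
    rw [abs_sub_comm, abs_of_nonneg (by linarith)]
    simp only [mmap]
    rw [abs_sub_comm, abs_of_nonneg hpos]
    simp [Nat.cast_sub h']
  ext k l
  rcases le_total (π k) (π l) with h | h
  · exact key k l h
  · rw [mmap_symm, key l k h, Matrix.add_apply, Matrix.add_apply, sum_apply2, sum_apply2]
    congr 1
    · exact mmap_symm _ _ _
    · exact Finset.sum_congr rfl fun i _ => by rw [mmap_symm]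

open Classical in
/-- Weights. -/
noncomputable def wv {m : ℕ} (π : Equiv.Perm (Fin (m+1))) (W : Set (Finset (Fin (m+1)))) (i : ℕ) : ℝ :=
  if preU π i ∈ W then 0 else 1

/-- The exposing functional. -/
noncomputable def fun0 {m : ℕ} (π : Equiv.Perm (Fin (m+1))) (W : Set (Finset (Fin (m+1)))) :
    Matrix (Fin (m+1)) (Fin (m+1)) ℝ →ₗ[ℝ] ℝ where
  toFun X := ∑ i ∈ Finset.range m, (1 + wv π W i) * X (posn π i) (posn π (i+1))
      - X (posn π 0) (posn π m)
  map_add' X Y := by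
    simp only [Matrix.add_apply, mul_add, Finset.sum_add_distrib]; ring
  map_smul' a X := by
    simp only [Matrix.smul_apply, smul_eq_mul, RingHom.id_apply, mul_sub, Finset.mul_sum]
    congr 1
    exact Finset.sum_congr rfl fun i _ => by ring

lemma fun0_eq {m : ℕ} (π : Equiv.Perm (Fin (m+1))) (W : Set (Finset (Fin (m+1))))
    (X : Matrix (Fin (m+1)) (Fin (m+1)) ℝ) :
    fun0 π W X - ∑ i ∈ Finset.range m, wv π W i =
      (∑ i ∈ Finset.range m, X (posn π i) (posn π (i+1)) - X (posn π 0) (posn π m))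
      + ∑ i ∈ Finset.range m, wv π W i * (X (posn π i) (posn π (i+1)) - 1) := by
  simp only [fun0, LinearMap.coe_mk, AddHom.coe_mk, add_mul, one_mul, mul_sub, mul_one,
    Finset.sum_add_distrib, Finset.sum_sub_distrib]
  ring

lemma ebn_case {m : ℕ} (π : Equiv.Perm (Fin (m+1))) (W : Set (Finset (Fin (m+1))))
    (x : Fin (m+1) → ℝ) (hx : ∀ k l, k ≠ l → 1 ≤ |x k - x l|) :
    ∑ i ∈ Finset.range m, wv π W i ≤ fun0 π W (mmap x) ∧
    (fun0 π W (mmap x) = ∑ i ∈ Finset.range m, wv π W i → mmap x ∈ faceSet π W) := by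
  classical
  obtain ⟨s, hs, hs0⟩ : ∃ s : ℝ, (s = 1 ∨ s = -1) ∧
      |x (posn π 0) - x (posn π m)| = s * x (posn π m) - s * x (posn π 0) := by
    rcases le_total (x (posn π 0)) (x (posn π m)) with h | h
    · exact ⟨1, Or.inl rfl, by rw [abs_of_nonpos (by linarith)]; ring⟩
    · exact ⟨-1, Or.inr rfl, by rw [abs_of_nonneg (by linarith)]; ring⟩
  have hsabs : ∀ k l, |s * x l - s * x k| = |x k - x l| := by
    intro k l
    rcases hs with rfl | rfl
    · rw [abs_sub_comm]; simp
    · congr 1; ring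
  have hd : ∀ i < m, 1 ≤ |x (posn π i) - x (posn π (i+1))| := by
    intro i hi
    apply hx
    intro h
    have := congrArg (fun j => ((π j : Fin (m+1)) : ℕ)) h
    simp only [pi_posn π i (by omega), pi_posn π (i+1) (by omega)] at this
    omega
  have ht := Finset.sum_range_sub (fun i => s * x (posn π i)) m
  have h1 : ∀ i ∈ Finset.range m, 0 ≤ |x (posn π i) - x (posn π (i+1))|
      - (s * x (posn π (i+1)) - s * x (posn π i)) := by
    intro i _
    rw [← hsabs]
    linarith [le_abs_self (s * x (posn π (i+1)) - s * x (posn π i))]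
  have hwv : ∀ i, 0 ≤ wv π W i := by intro i; unfold wv; split_ifs <;> norm_num
  have h2 : ∀ i ∈ Finset.range m, 0 ≤ wv π W i * (|x (posn π i) - x (posn π (i+1))| - 1) := by
    intro i hi
    exact mul_nonneg (hwv i) (by linarith [hd i (Finset.mem_range.mp hi)])
  have hE := fun0_eq π W (mmap x)
  simp only [mmap] at hE
  rw [hs0, ← ht, ← Finset.sum_sub_distrib] at hE
  have n1 := Finset.sum_nonneg h1
  have n2 := Finset.sum_nonneg h2
  refine ⟨by linarith, fun heq => ?_⟩
  have z1 := (Finset.sum_eq_zero_iff_of_nonneg h1).mp (by linarith)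
  have z2 := (Finset.sum_eq_zero_iff_of_nonneg h2).mp (by linarith)
  have hmz : mmap x = mmap (fun k => s * x k) := by
    ext k l
    simp only [mmap]
    rw [abs_sub_comm (s * x k), hsabs]
  have hgap : ∀ i < m, 1 ≤ s * x (posn π (i+1)) - s * x (posn π i) := by
    intro i hi
    have := z1 i (Finset.mem_range.mpr hi)
    linarith [hd i hi]
  have hdec := mono_decomp π (fun k => s * x k) (fun i hi => by linarith [hgap i hi])
  refine ⟨fun U => ∑ i ∈ Finset.range m, if preU π i = U then
      s * x (posn π (i+1)) - s * x (posn π i) - 1 else 0, fun U => ?_, fun U hU => ?_, ?_⟩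
  · apply Finset.sum_nonneg
    intro i hi
    split_ifs
    · linarith [hgap i (Finset.mem_range.mp hi)]
    · exact le_rfl
  · by_contra hn
    apply hU
    apply Finset.sum_eq_zero
    intro i hi
    split_ifs with h
    · have e1 := z1 i hi
      have e2 := z2 i hi
      have : wv π W i = 1 := by unfold wv; rw [if_neg (by rw [h]; exact hn)]
      rw [this] at e2
      linarith
    · rfl
  · rw [hmz, hdec]
    congr 1
    simp only [Finset.sum_smul]
    rw [Finset.sum_comm]
    apply Finset.sum_congr rfl
    intro i _
    simp [ite_smul]

lemma face_case {m : ℕ} (π : Equiv.Perm (Fin (m+1))) (W : Set (Finset (Fin (m+1))))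
    (hW : ∀ U ∈ W, incident π U) (X : Matrix (Fin (m+1)) (Fin (m+1)) ℝ) (hX : X ∈ faceSet π W) :
    X ∈ Qn (m+1) ∧ fun0 π W X = ∑ i ∈ Finset.range m, wv π W i := by
  classical
  obtain ⟨lam, h0, hl, rfl⟩ := hX
  constructor
  · apply subset_convexHull
    have key : ∀ k l, π k ≤ π l →
        ((Mperm π + ∑ U : Finset (Fin (m+1)), lam U • mmap (chi U)) k l =
          (permVec π l - ∑ U, lam U * chi U l) - (permVec π k - ∑ U, lam U * chi U k)) ∧
        ((π l : ℕ) : ℝ) - ((π k : ℕ) : ℝ) ≤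
          (Mperm π + ∑ U : Finset (Fin (m+1)), lam U • mmap (chi U)) k l := by
      intro k l h
      have hc : ((π k : ℕ) : ℝ) ≤ ((π l : ℕ) : ℝ) := by exact_mod_cast h
      have hU : ∀ U, lam U * mmap (chi U) k l = lam U * chi U k - lam U * chi U l := by
        intro U
        by_cases hz : lam U = 0
        · simp [hz]
        · obtain ⟨i, _, rfl⟩ := incident_pre π U (hW U (hl U hz))
          rw [chi_pre π i k l h, ← mul_sub]
          congr 1
          have h' : (π k : ℕ) ≤ π l := h
          simp only [chi, preU, Finset.mem_filter, Finset.mem_univ, true_and, Finset.mem_Ico]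
          split_ifs <;> first | omega | simp
      have hn : 0 ≤ ∑ U, lam U * mmap (chi U) k l :=
        Finset.sum_nonneg fun U _ => mul_nonneg (h0 U) (abs_nonneg _)
      rw [Matrix.add_apply, sum_apply2, mperm_apply, abs_sub_comm, abs_of_nonneg (by linarith)]
      refine ⟨?_, by linarith⟩
      simp only [hU, Finset.sum_sub_distrib, permVec]
      ring
    have hsym : ∀ k l, (Mperm π + ∑ U : Finset (Fin (m+1)), lam U • mmap (chi U)) k l =
        (Mperm π + ∑ U : Finset (Fin (m+1)), lam U • mmap (chi U)) l k := by
      intro k l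
      rw [Matrix.add_apply, Matrix.add_apply, sum_apply2, sum_apply2]
      congr 1
      · exact mmap_symm _ _ _
      · exact Finset.sum_congr rfl fun i _ => by rw [mmap_symm]
    have hm : ∀ k l, π k ≤ π l →
        (Mperm π + ∑ U : Finset (Fin (m+1)), lam U • mmap (chi U)) k l
          = mmap (fun j => permVec π j - ∑ U, lam U * chi U j) k l := by
      intro k l h
      obtain ⟨e1, e2⟩ := key k l h
      have hc : ((π k : ℕ) : ℝ) ≤ ((π l : ℕ) : ℝ) := by exact_mod_cast h
      simp only [mmap]
      rw [abs_sub_comm, abs_of_nonneg (by rw [← e1]; linarith)]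
      exact e1
    have hm' : Mperm π + ∑ U : Finset (Fin (m+1)), lam U • mmap (chi U)
          = mmap (fun j => permVec π j - ∑ U, lam U * chi U j) := by
      ext k l
      rcases le_total (π k) (π l) with h | h
      · exact hm k l h
      · rw [hsym, mmap_symm]; exact hm l k h
    refine ⟨fun j => permVec π j - ∑ U, lam U * chi U j, ?_, hm'⟩
    have hlt : ∀ k l, π k < π l →
        1 ≤ mmap (fun j => permVec π j - ∑ U, lam U * chi U j) k l := by
      intro k l h
      rw [← hm']
      have := (key k l h.le).2
      have hc : ((π k : ℕ) : ℝ) + 1 ≤ ((π l : ℕ) : ℝ) := by exact_mod_cast h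
      linarith
    intro k l hkl
    rcases lt_or_gt_of_ne (fun h => hkl (π.injective h) : π k ≠ π l) with h | h
    · exact hlt k l h
    · have := hlt l k h
      rw [mmap_symm] at this
      exact this
  · rw [map_add, map_sum]
    have hp : ∀ i ∈ Finset.range m, Mperm π (posn π i) (posn π (i+1)) = 1 := by
      intro i hi
      rw [Finset.mem_range] at hi
      rw [mperm_apply, pi_posn π i (by omega), pi_posn π (i+1) (by omega)]
      simp
    have hM : fun0 π W (Mperm π) = ∑ i ∈ Finset.range m, wv π W i := by
      have hz : ∑ i ∈ Finset.range m,
          wv π W i * (Mperm π (posn π i) (posn π (i+1)) - 1) = 0 :=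
        Finset.sum_eq_zero (fun i hi => by rw [hp i hi]; simp)
      rw [← sub_eq_zero, fun0_eq, Finset.sum_congr rfl hp, hz, mperm_apply,
        pi_posn π 0 (by omega), pi_posn π m le_rfl]
      simp
    rw [hM, add_eq_left]
    apply Finset.sum_eq_zero
    intro U _
    rw [map_smul]
    by_cases hz : lam U = 0
    · simp [hz]
    · have hUW := hl U hz
      obtain ⟨i, hi, rfl⟩ := incident_pre π U (hW U hUW)
      have hle : ∀ j < m, π (posn π j) ≤ π (posn π (j+1)) := by
        intro j hj
        change ((π (posn π j) : Fin (m+1)) : ℕ) ≤ ((π (posn π (j+1)) : Fin (m+1)) : ℕ)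
        rw [pi_posn π j (by omega), pi_posn π (j+1) (by omega)]
        omega
      have hval : ∀ j ∈ Finset.range m, (1 + wv π W j) *
          mmap (chi (preU π i)) (posn π j) (posn π (j+1)) = if i = j then 1 else 0 := by
        intro j hj
        rw [Finset.mem_range] at hj
        rw [chi_pre π i _ _ (hle j hj), pi_posn π j (by omega), pi_posn π (j+1) (by omega)]
        by_cases hij : i = j
        · subst hij
          simp [wv, hUW]
        · rw [if_neg hij, if_neg (by rw [Finset.mem_Ico]; omega), mul_zero]
      have h0m : π (posn π 0) ≤ π (posn π m) := by
        change ((π (posn π 0) : Fin (m+1)) : ℕ) ≤ ((π (posn π m) : Fin (m+1)) : ℕ)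
        rw [pi_posn π 0 (by omega), pi_posn π m le_rfl]
        omega
      have : fun0 π W (mmap (chi (preU π i))) = 0 := by
        simp only [fun0, LinearMap.coe_mk, AddHom.coe_mk]
        rw [Finset.sum_congr rfl hval, chi_pre π i _ _ h0m, pi_posn π 0 (by omega),
          pi_posn π m le_rfl]
        simp [hi]
      rw [this, smul_zero]

theorem stmt10 (n : ℕ) (hn : 3 ≤ n) (π : Equiv.Perm (Fin n)) (W : Set (Finset (Fin n)))
    (hW : ∀ U ∈ W, incident π U) :
    ∃ f : Matrix (Fin n) (Fin n) ℝ →ₗ[ℝ] ℝ, ∃ c : ℝ,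
      (∀ X ∈ Qn n, c ≤ f X) ∧
      {X ∈ Qn n | f X = c} =
        {X | ∃ lam : Finset (Fin n) → ℝ, (∀ U, 0 ≤ lam U) ∧ (∀ U, lam U ≠ 0 → U ∈ W) ∧
          X = Mperm π + ∑ U : Finset (Fin n), lam U • mmap (chi U)} := by
  obtain ⟨m, rfl⟩ : ∃ m, n = m + 1 := ⟨n - 1, by omega⟩
  set c := ∑ i ∈ Finset.range m, wv π W i with hc
  have hQ : Qn (m+1) ⊆ {X | c ≤ fun0 π W X ∧ (fun0 π W X = c → X ∈ faceSet π W)} := by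
    apply convexHull_min
    · rintro X ⟨x, hx, rfl⟩
      exact ebn_case π W x hx
    · rintro X ⟨hX1, hX2⟩ Y ⟨hY1, hY2⟩ a b ha hb hab
      have hlin : fun0 π W (a • X + b • Y) - c
          = a * (fun0 π W X - c) + b * (fun0 π W Y - c) := by
        rw [map_add, map_smul, map_smul, smul_eq_mul, smul_eq_mul]
        linear_combination c * hab
      have p1 : 0 ≤ a * (fun0 π W X - c) := mul_nonneg ha (by linarith)
      have p2 : 0 ≤ b * (fun0 π W Y - c) := mul_nonneg hb (by linarith)
      refine ⟨by linarith, fun heq => ?_⟩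
      have q1 : a * (fun0 π W X - c) = 0 := by linarith
      have q2 : b * (fun0 π W Y - c) = 0 := by linarith
      rcases mul_eq_zero.mp q1 with h | h
      · have hb1 : b = 1 := by linarith
        subst h; subst hb1
        simp only [zero_smul, one_smul, zero_add] at heq ⊢
        exact hY2 heq
      · rcases mul_eq_zero.mp q2 with h' | h'
        · have ha1 : a = 1 := by linarith
          subst h'; subst ha1
          simp only [zero_smul, one_smul, add_zero] at heq ⊢
          exact hX2 heq
        · exact faceSet_convex π W (hX2 (by linarith)) (hY2 (by linarith)) ha hb hab
  refine ⟨fun0 π W, c, fun X hX => (hQ hX).1, ?_⟩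
  change {X ∈ Qn (m+1) | fun0 π W X = c} = faceSet π W
  ext X
  constructor
  · rintro ⟨h1, h2⟩
    exact (hQ h1).2 h2
  · intro h
    exact face_case π W hW X h
end
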